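/- For every integer k ≥ 1 there exists a constant C > 0 such that for every n ≥ 1 and every undirected graph 𝒢 on vertex set {1,…,n} (with any choice of injection code(·) and any fixed linear order on the 2k-cliques), there exists a context-free grammar G over the terminal alphabet Σ with at most C·n^{2k} production rules, each rule having a right-hand side of length at most 2, whose generated language is exactly the singleton {w(𝒢)}. -/

import Mathlib

/-- The alphabet `Σ = {1,…,N} ∪ {$, #, γ, μ, α, β}`: numeric symbols together
with six distinct special symbols. -/
inductive Letter where
  | num : ℕ → Letter
  | dollar : Letter
  | hash : Letter
  | gam : Letter
  | mu : Letter
  | alp : Letter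
  | bet : Letter
deriving DecidableEq

/-- The string of numeric symbols `a·(a+1)⋯(a+len−1)`. -/
def nums (a len : ℕ) : List Letter := (List.range len).map (fun t => Letter.num (a + t))

/-- `Low(b) = 1·2⋯(b−1)` (empty if `b = 1`). -/
def low (b : ℕ) : List Letter := nums 1 (b - 1)

/-- `High(b) = b·(b+1)⋯N`. -/
def high (N b : ℕ) : List Letter := nums b (N + 1 - b)

/-- The string `1·2⋯N`. -/
def full (N : ℕ) : List Letter := nums 1 N

/-- For a `2k`-clique `A = {a_1 < ⋯ < a_{2k}}`, the gadget string
`w_A = $·(1 2⋯N)·#·a_1·#·(1 2⋯N)·#·a_2·#·⋯·#·a_{2k}·#·(1 2⋯N)·$`.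
A vertex `a : Fin n` is written as the numeric symbol `a+1 ∈ {1,…,n}`. -/
def wordA (n N : ℕ) (A : Finset (Fin n)) : List Letter :=
  Letter.dollar :: (full N ++
    (A.sort (· ≤ ·)).flatMap (fun a => Letter.hash :: Letter.num (a.val + 1) :: Letter.hash :: full N) ++
    [Letter.dollar])

/-- `f₀(s₁s₂⋯sₗ) = (α s₁ β)(α s₂ β)⋯(α sₗ β)`. -/
def f0 (s : List Letter) : List Letter :=
  s.flatMap (fun c => [Letter.alp, c, Letter.bet])

/-- The string `w(𝒢) = (∏_A f₀(μ·w_A·γ·w_A·μ))·μμ`, where the concatenation is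
over the list `As` of all `2k`-cliques of `𝒢` in a fixed order. -/
def wordG (n N : ℕ) (As : List (Finset (Fin n))) : List Letter :=
  (As.flatMap (fun A =>
      f0 (Letter.mu :: wordA n N A ++ Letter.gam :: wordA n N A ++ [Letter.mu]))) ++
    [Letter.mu, Letter.mu]

namespace ContextFreeGrammar

variable {T : Type}

/-- The word a sentential form stands for, when every nonterminal is named by the word it is meant
to generate. -/
def wordValue (s : List (Symbol T (List T))) : List T :=
  s.flatMap fun
    | .terminal a => [a]
    | .nonterminal w => w

theorem wordValue_append (s t : List (Symbol T (List T))) :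
    wordValue (s ++ t) = wordValue s ++ wordValue t :=
  List.flatMap_append

theorem wordValue_nonterminal (w : List T) : wordValue [.nonterminal w] = w := by
  simp [wordValue]

theorem wordValue_map_terminal (w : List T) : wordValue (w.map Symbol.terminal) = w := by
  simp [wordValue, List.flatMap_map]

/-- Some number of rewriting steps by rules from `R`. -/
def RulesDerive (R : Finset (ContextFreeRule T (List T))) :
    List (Symbol T (List T)) → List (Symbol T (List T)) → Prop :=
  Relation.ReflTransGen fun s t => ∃ r ∈ R, r.Rewrites s t

/-- All rules preserve `wordValue` and have right-hand sides of length at most `2`. -/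
def IsWordRules (R : Finset (ContextFreeRule T (List T))) : Prop :=
  ∀ r ∈ R, wordValue r.output = r.input ∧ r.output.length ≤ 2

/-- The nonterminal `w` derives the word `w`. -/
def Spells (R : Finset (ContextFreeRule T (List T))) (w : List T) : Prop :=
  RulesDerive R [.nonterminal w] (w.map Symbol.terminal)

variable {R S : Finset (ContextFreeRule T (List T))} {u v w : List T} {c d : ℕ}

theorem RulesDerive.mono {s t : List (Symbol T (List T))} (hst : RulesDerive R s t)
    (h : R ⊆ S) : RulesDerive S s t :=
  Relation.ReflTransGen.lift id (fun _ _ ⟨r, hr, hrw⟩ => ⟨r, h hr, hrw⟩) _ _ hst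

theorem RulesDerive.append {s s' t t' : List (Symbol T (List T))} (hs : RulesDerive R s s')
    (ht : RulesDerive R t t') : RulesDerive R (s ++ t) (s' ++ t') :=
  Relation.ReflTransGen.trans
    (Relation.ReflTransGen.lift (· ++ t) (fun _ _ ⟨r, hr, hrw⟩ => ⟨r, hr, hrw.append_right t⟩)
      _ _ hs)
    (Relation.ReflTransGen.lift (s' ++ ·) (fun _ _ ⟨r, hr, hrw⟩ => ⟨r, hr, hrw.append_left s'⟩)
      _ _ ht)

theorem Spells.mono (hw : Spells R w) (h : R ⊆ S) : Spells S w :=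
  RulesDerive.mono hw h

theorem IsWordRules.wordValue_eq (hR : IsWordRules R) {s t : List (Symbol T (List T))}
    (hst : RulesDerive R s t) : wordValue s = wordValue t := by
  induction hst with
  | refl => rfl
  | tail _ last ih =>
    obtain ⟨r, hr, hrw⟩ := last
    obtain ⟨p, q, rfl, rfl⟩ := hrw.exists_parts
    rw [ih]
    simp only [wordValue_append]
    rw [(hR r hr).1, wordValue_nonterminal]

theorem IsWordRules.language_eq (hR : IsWordRules R) (hw : Spells R w) :
    ContextFreeGrammar.language ⟨List T, w, R⟩ = {w} := by
  ext x
  refine ⟨fun hx => ?_, ?_⟩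
  · have h : wordValue [.nonterminal w] = wordValue (x.map Symbol.terminal) := hR.wordValue_eq hx
    rw [wordValue_map_terminal, wordValue_nonterminal] at h
    exact h.symm
  · rintro rfl
    exact hw

/-- Any valid set of rules containing `R` can be enlarged by at most `c` rules so as to derive the
word `w`. -/
def SpellCost (R : Finset (ContextFreeRule T (List T))) (c : ℕ) (w : List T) : Prop :=
  ∀ R', R ⊆ R' → IsWordRules R' →
    ∃ R'', R' ⊆ R'' ∧ IsWordRules R'' ∧ R''.card ≤ R'.card + c ∧ Spells R'' w

theorem Spells.spellCost (hw : Spells R w) : SpellCost R 0 w :=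
  fun R' h hR' => ⟨R', subset_rfl, hR', le_rfl, hw.mono h⟩

theorem SpellCost.mono (hw : SpellCost R c w) (h : c ≤ d) : SpellCost R d w := by
  intro R' hR hR'
  obtain ⟨R'', h₁, h₂, h₃, h₄⟩ := hw R' hR hR'
  exact ⟨R'', h₁, h₂, by omega, h₄⟩

theorem IsWordRules.exists_insert (hR : IsWordRules R) {s : List (Symbol T (List T))}
    (hs : wordValue s = w) (hlen : s.length ≤ 2)
    (hder : RulesDerive R s (w.map Symbol.terminal)) :
    ∃ S, R ⊆ S ∧ IsWordRules S ∧ S.card ≤ R.card + 1 ∧ Spells S w := by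
  classical
  refine ⟨insert ⟨w, s⟩ R, Finset.subset_insert _ _, ?_, Finset.card_insert_le _ _, ?_⟩
  · intro r hr
    rcases Finset.mem_insert.1 hr with rfl | hr
    · exact ⟨hs, hlen⟩
    · exact hR r hr
  · refine Relation.ReflTransGen.head ⟨⟨w, s⟩, Finset.mem_insert_self _ _, ?_⟩
      (hder.mono (Finset.subset_insert _ _))
    exact ContextFreeRule.Rewrites.input_output (r := ⟨w, s⟩)

theorem spellCost_nil : SpellCost R 1 ([] : List T) := fun _ _ hR' =>
  hR'.exists_insert (s := []) rfl (by simp) Relation.ReflTransGen.refl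

theorem spellCost_singleton (a : T) : SpellCost R 1 [a] := fun _ _ hR' =>
  hR'.exists_insert (s := [.terminal a]) rfl (by simp) Relation.ReflTransGen.refl

theorem SpellCost.append (hu : SpellCost R c u) (hv : SpellCost R d v) :
    SpellCost R (c + d + 1) (u ++ v) := by
  intro R₁ h₁ hR₁
  obtain ⟨R₂, h₂, hR₂, hc₂, hu₂⟩ := hu R₁ h₁ hR₁
  obtain ⟨R₃, h₃, hR₃, hc₃, hv₃⟩ := hv R₂ (h₁.trans h₂) hR₂
  have hder : RulesDerive R₃ [.nonterminal u, .nonterminal v]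
      ((u ++ v).map Symbol.terminal) := by
    rw [List.map_append]
    exact (hu₂.mono h₃).append hv₃
  obtain ⟨R₄, h₄, hR₄, hc₄, huv⟩ :=
    hR₃.exists_insert (by simp [wordValue]) (by simp) hder
  exact ⟨R₄, h₂.trans (h₃.trans h₄), hR₄, by omega, huv⟩

theorem SpellCost.flatMap {ι : Type*} {f : ι → List T} (l : List ι)
    (h : ∀ x ∈ l, SpellCost R c (f x)) :
    SpellCost R (l.length * (c + 1) + 1) (l.flatMap f) := by
  induction l with
  | nil => exact spellCost_nil.mono (by simp)
  | cons x l ih =>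
    rw [List.flatMap_cons]
    refine ((h x (by simp)).append (ih fun y hy => h y (by simp [hy]))).mono ?_
    rw [List.length_cons]
    linarith

end ContextFreeGrammar

open ContextFreeGrammar

theorem f0_append (s t : List Letter) : f0 (s ++ t) = f0 s ++ f0 t :=
  List.flatMap_append

theorem f0_cons (c : Letter) (s : List Letter) : f0 (c :: s) = f0 [c] ++ f0 s := by
  simp [f0]

theorem f0_flatMap {ι : Type*} (l : List ι) (f : ι → List Letter) :
    f0 (l.flatMap f) = l.flatMap fun x => f0 (f x) :=
  List.flatMap_assoc

section

variable {R : Finset (ContextFreeRule Letter (List Letter))}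

theorem spellCost_f0_singleton (c : Letter) : SpellCost R 5 (f0 [c]) :=
  (spellCost_singleton Letter.alp).append
    ((spellCost_singleton c).append (spellCost_singleton Letter.bet))

theorem ContextFreeGrammar.SpellCost.f0_cons {d : ℕ} {s : List Letter} (c : Letter) (hs : SpellCost R d (f0 s)) :
    SpellCost R (d + 6) (f0 (c :: s)) := by
  rw [_root_.f0_cons]
  exact ((spellCost_f0_singleton c).append hs).mono (by omega)

theorem spellCost_f0_full (N : ℕ) : SpellCost R (N * 6 + 1) (f0 (full N)) := by
  rw [full, nums, f0, List.flatMap_map]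
  refine (SpellCost.flatMap (c := 5) (List.range N) fun t _ => ?_).mono (by simp)
  exact spellCost_f0_singleton (R := R) (Letter.num (1 + t))

theorem spellCost_f0_wordA {n N : ℕ} (A : Finset (Fin n)) (h : Spells R (f0 (full N))) :
    SpellCost R (A.card * 19 + 15) (f0 (wordA n N A)) := by
  rw [wordA]
  refine (SpellCost.f0_cons (d := A.card * 19 + 9) _ ?_).mono (by omega)
  rw [f0_append, f0_append, f0_flatMap]
  refine ((h.spellCost.append (SpellCost.flatMap (c := 18) _ fun a _ => ?_)).append
    (spellCost_f0_singleton _)).mono ?_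
  · exact ((h.spellCost.f0_cons _).f0_cons _).f0_cons _
  · rw [Finset.length_sort]
    omega

theorem spellCost_wordG {n N m : ℕ} {As : List (Finset (Fin n))} (hA : ∀ A ∈ As, A.card = m)
    (h : Spells R (f0 (full N))) :
    SpellCost R (As.length * (38 * m + 50) + 5) (wordG n N As) := by
  rw [wordG]
  refine ((SpellCost.flatMap (c := 38 * m + 49) As fun A hAs => ?_).append
    ((spellCost_singleton Letter.mu).append (spellCost_singleton Letter.mu))).mono le_rfl
  have hw := spellCost_f0_wordA A h
  rw [hA A hAs] at hw
  rw [f0_append, f0_append]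
  exact (((hw.f0_cons _).append (hw.f0_cons _)).append (spellCost_f0_singleton _)).mono (by omega)

end

theorem List.Nodup.length_le_pow_of_card_eq {n m : ℕ} {l : List (Finset (Fin n))} (hl : l.Nodup)
    (h : ∀ A ∈ l, A.card = m) : l.length ≤ n ^ m := by
  rw [← List.toFinset_card_of_nodup hl]
  calc l.toFinset.card ≤ (Finset.powersetCard m (Finset.univ : Finset (Fin n))).card :=
        Finset.card_le_card fun A hA =>
          Finset.mem_powersetCard.2 ⟨Finset.subset_univ _, h A (List.mem_toFinset.1 hA)⟩
    _ = n.choose m := by simp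
    _ ≤ n ^ m := Nat.choose_le_pow n m

theorem stmt11 (k : ℕ) (hk : 1 ≤ k) :
    ∃ C : ℕ, 0 < C ∧ ∀ n : ℕ, 1 ≤ n →
      ∀ (G : SimpleGraph (Fin n)) (code : Finset (Fin n) → ℕ),
        (∀ B : Finset (Fin n), G.IsNClique k B → 1 ≤ code B ∧ code B ≤ n ^ k) →
        (∀ B B' : Finset (Fin n),
          G.IsNClique k B → G.IsNClique k B' → code B = code B' → B = B') →
        ∀ As : List (Finset (Fin n)), As.Nodup →
          (∀ A : Finset (Fin n), A ∈ As ↔ G.IsNClique (2 * k) A) →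
          ∃ g : ContextFreeGrammar Letter,
            g.rules.card ≤ C * n ^ (2 * k) ∧
            (∀ r ∈ g.rules, r.output.length ≤ 2) ∧
            g.language = {wordG n (n ^ k) As} := by
  refine ⟨76 * k + 62, by omega, fun n hn G code _ _ As hAs hmem => ?_⟩
  have hcard : ∀ A ∈ As, A.card = 2 * k := fun A hA => ((hmem A).1 hA).card_eq
  obtain ⟨R₁, -, hR₁, hc₁, hfull⟩ :=
    spellCost_f0_full (n ^ k) ∅ (Finset.empty_subset _) fun r hr => absurd hr (by simp)
  obtain ⟨R₂, -, hR₂, hc₂, hw⟩ := spellCost_wordG hcard hfull R₁ subset_rfl hR₁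
  refine ⟨⟨List Letter, wordG n (n ^ k) As, R₂⟩, ?_, fun r hr => (hR₂ r hr).2, hR₂.language_eq hw⟩
  have hlen := hAs.length_le_pow_of_card_eq hcard
  have hN : n ^ k ≤ n ^ (2 * k) := Nat.pow_le_pow_right hn (by omega)
  have hpos : 1 ≤ n ^ (2 * k) := Nat.one_le_pow _ _ hn
  have hmul := Nat.mul_le_mul_right (38 * (2 * k) + 50) hlen
  change R₂.card ≤ (76 * k + 62) * n ^ (2 * k)
  rw [Finset.card_empty] at hc₁
  nlinarith
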